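/- Let A be a finite nonempty set of points in ℝ^d with centroid c(A) = (1/|A|) Σ_{x∈A} x. Let m ≥ 1 and 0 < δ ≤ 1, and let y_1, …, y_m be drawn independently and uniformly at random from A (with replacement), with sample mean c(S) = (1/m) Σ_{i=1}^m y_i. Then with probability at least 1 − δ, Σ_{x∈A} ‖x − c(S)‖² ≤ (1 + 1/(δ m)) · Σ_{x∈A} ‖x − c(A)‖². -/

import Mathlib

open Finset
open scoped Classical

/-- The centroid `c(A) = (1/|A|) ∑_{x ∈ A} x` of a finite set of points in `ℝ^d`. -/
noncomputable def centroid {d : ℕ} (A : Finset (EuclideanSpace ℝ (Fin d))) :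
    EuclideanSpace ℝ (Fin d) :=
  (A.card : ℝ)⁻¹ • ∑ x ∈ A, x

/-- Deviations from the centroid sum to zero. -/
lemma sum_sub_centroid {d : ℕ} (A : Finset (EuclideanSpace ℝ (Fin d))) (hA : A.Nonempty) :
    ∑ x ∈ A, (x - centroid A) = 0 := by
  have hcard : (A.card : ℝ) ≠ 0 := by exact_mod_cast hA.card_ne_zero
  rw [Finset.sum_sub_distrib, Finset.sum_const, ← Nat.cast_smul_eq_nsmul ℝ, _root_.centroid,
    smul_inv_smul₀ hcard, sub_self]

/-- The sum of squared distances to `s` splits into the sum of squared distances to the centroid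
and a multiple of the squared distance from `s` to the centroid. -/
lemma sum_norm_sub_sq_eq_centroid {d : ℕ} (A : Finset (EuclideanSpace ℝ (Fin d)))
    (hA : A.Nonempty) (s : EuclideanSpace ℝ (Fin d)) :
    ∑ x ∈ A, ‖x - s‖ ^ 2 = ∑ x ∈ A, ‖x - centroid A‖ ^ 2 + A.card * ‖s - centroid A‖ ^ 2 := by
  have hexp (x : EuclideanSpace ℝ (Fin d)) : ‖x - s‖ ^ 2 =
      ‖x - centroid A‖ ^ 2 - 2 * inner ℝ (x - centroid A) (s - centroid A)
        + ‖s - centroid A‖ ^ 2 := by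
    rw [← norm_sub_sq_real, sub_sub_sub_cancel_right]
  simp_rw [hexp]
  rw [Finset.sum_add_distrib, Finset.sum_sub_distrib, ← Finset.mul_sum, ← sum_inner,
    sum_sub_centroid A hA]
  simp

/-- Second moment of a sum of `m` independent uniform samples of a centred family. -/
lemma card_mul_sum_norm_sum_sq {ι E : Type*} [Fintype ι] [NormedAddCommGroup E]
    [InnerProductSpace ℝ E] (f : ι → E) (hf : ∑ a, f a = 0) (m : ℕ) :
    (Fintype.card ι : ℝ) * ∑ y : Fin m → ι, ‖∑ i, f (y i)‖ ^ 2 =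
      m * (Fintype.card ι : ℝ) ^ m * ∑ a, ‖f a‖ ^ 2 := by
  induction m with
  | zero => simp
  | succ m ih =>
    have hstep : ∑ y : Fin (m + 1) → ι, ‖∑ i, f (y i)‖ ^ 2 =
        (Fintype.card ι : ℝ) ^ m * ∑ a, ‖f a‖ ^ 2 +
          Fintype.card ι * ∑ y : Fin m → ι, ‖∑ i, f (y i)‖ ^ 2 := by
      rw [← (Fin.consEquiv fun _ : Fin (m + 1) => ι).sum_comp, Fintype.sum_prod_type_right]
      simp only [Fin.consEquiv_apply, Fin.sum_univ_succ, Fin.cons_zero, Fin.cons_succ,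
        norm_add_sq_real, Finset.sum_add_distrib, ← Finset.mul_sum, ← sum_inner, hf,
        inner_zero_left]
      simp [Finset.mul_sum]
    rw [hstep, ih]
    push_cast
    ring

/-- Markov's inequality for the uniform distribution on a finite type, in counting form; the
threshold may be zero. -/
lemma one_sub_mul_card_le_card_filter_le {Ω : Type*} [Fintype Ω] (g : Ω → ℝ) (hg : ∀ ω, 0 ≤ g ω)
    {δ T : ℝ} (hδ : 0 ≤ δ) (hT : 0 ≤ T) (hsum : ∑ ω, g ω ≤ δ * T * Fintype.card Ω) :
    (1 - δ) * (Fintype.card Ω : ℝ) ≤ ((Finset.univ.filter fun ω => g ω ≤ T).card : ℝ) := by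
  have hsplit := Finset.card_filter_add_card_filter_not (s := (Finset.univ : Finset Ω))
    (fun ω => g ω ≤ T)
  rw [Finset.card_univ] at hsplit
  have hsplit_real : ((Finset.univ.filter fun ω => g ω ≤ T).card : ℝ) +
      (Finset.univ.filter fun ω => ¬ g ω ≤ T).card = Fintype.card Ω := by exact_mod_cast hsplit
  suffices ((Finset.univ.filter fun ω => ¬ g ω ≤ T).card : ℝ) ≤ δ * Fintype.card Ω by linarith
  rcases hT.eq_or_lt with rfl | hT
  · have hle (ω : Ω) : g ω ≤ 0 :=
      (Finset.single_le_sum (fun ω _ => hg ω) (Finset.mem_univ ω)).trans (by simpa using hsum)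
    simp only [hle, not_true_eq_false, Finset.filter_false, Finset.card_empty, Nat.cast_zero]
    positivity
  · refine le_of_mul_le_mul_right ?_ hT
    calc ((Finset.univ.filter fun ω => ¬ g ω ≤ T).card : ℝ) * T
        ≤ ∑ ω with ¬ g ω ≤ T, g ω := by
          rw [← nsmul_eq_mul]
          exact Finset.card_nsmul_le_sum _ _ _ fun ω hω =>
            (not_le.mp (Finset.mem_filter.mp hω).2).le
      _ ≤ ∑ ω, g ω :=
          Finset.sum_le_sum_of_subset_of_nonneg (Finset.filter_subset _ _) fun ω _ _ => hg ω
      _ ≤ δ * Fintype.card Ω * T := by linarith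

/-- Inaba's lemma: if `y₁, …, y_m` are sampled independently and uniformly (with
replacement) from a finite nonempty set `A ⊆ ℝ^d` and `c(S) = (1/m) ∑ᵢ yᵢ`, then with
probability at least `1 − δ`,
`∑_{x∈A} ‖x − c(S)‖² ≤ (1 + 1/(δm)) · ∑_{x∈A} ‖x − c(A)‖²`.
The probability is expressed by counting the sample tuples `y : Fin m → A`. -/
theorem inaba_lemma {d : ℕ} (A : Finset (EuclideanSpace ℝ (Fin d))) (hA : A.Nonempty)
    {m : ℕ} (hm : 1 ≤ m) (δ : ℝ) (hδ0 : 0 < δ) (hδ1 : δ ≤ 1) :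
    (1 - δ) * (Fintype.card (Fin m → A) : ℝ) ≤
      ((Finset.univ.filter (fun y : Fin m → A =>
          ∑ x ∈ A, ‖x - (m : ℝ)⁻¹ • ∑ i, (y i : EuclideanSpace ℝ (Fin d))‖ ^ 2 ≤
            (1 + 1 / (δ * m)) * ∑ x ∈ A, ‖x - centroid A‖ ^ 2)).card : ℝ) := by
  have hm0 : (m : ℝ) ≠ 0 := by positivity
  set Φ : ℝ := ∑ x ∈ A, ‖x - centroid A‖ ^ 2 with hΦ
  have hΦ0 : 0 ≤ Φ := by positivity
  have hzero : ∑ a : A, ((a : EuclideanSpace ℝ (Fin d)) - centroid A) = 0 := by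
    rw [Finset.sum_coe_sort A fun x => x - centroid A, sum_sub_centroid A hA]
  have hmean (y : Fin m → A) :
      (m : ℝ)⁻¹ • ∑ i, (y i : EuclideanSpace ℝ (Fin d)) - centroid A =
        (m : ℝ)⁻¹ • ∑ i, ((y i : EuclideanSpace ℝ (Fin d)) - centroid A) := by
    rw [Finset.sum_sub_distrib, Finset.sum_const, Finset.card_univ, Fintype.card_fin,
      ← Nat.cast_smul_eq_nsmul ℝ, smul_sub, inv_smul_smul₀ hm0]
  have hmoment := card_mul_sum_norm_sum_sq
    (fun a : A => (a : EuclideanSpace ℝ (Fin d)) - centroid A) hzero m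
  rw [Finset.sum_coe_sort A fun x => ‖x - centroid A‖ ^ 2, ← hΦ, Fintype.card_coe] at hmoment
  have hmarkov := one_sub_mul_card_le_card_filter_le
    (fun y : Fin m → A =>
      A.card * ‖(m : ℝ)⁻¹ • ∑ i, (y i : EuclideanSpace ℝ (Fin d)) - centroid A‖ ^ 2)
    (fun y => by positivity) hδ0.le (T := 1 / (δ * m) * Φ) (by positivity) (by
      simp only [hmean, norm_smul, mul_pow, ← Finset.mul_sum]
      rw [mul_left_comm, hmoment]
      simp only [norm_inv, Real.norm_natCast, Fintype.card_fun, Fintype.card_coe, Fintype.card_fin,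
        Nat.cast_pow]
      apply le_of_eq
      field_simp)
  have hiff (y : Fin m → A) :
      ∑ x ∈ A, ‖x - (m : ℝ)⁻¹ • ∑ i, (y i : EuclideanSpace ℝ (Fin d))‖ ^ 2 ≤
          (1 + 1 / (δ * m)) * Φ ↔
        A.card * ‖(m : ℝ)⁻¹ • ∑ i, (y i : EuclideanSpace ℝ (Fin d)) - centroid A‖ ^ 2 ≤
          1 / (δ * m) * Φ := by
    rw [sum_norm_sub_sq_eq_centroid A hA, ← hΦ, add_mul, one_mul, add_le_add_iff_left]
  simpa only [hiff] using hmarkov
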